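/- In the Artin group of type I₂(m) with m = 2k + 1 odd, the pair (H, G₁) satisfies Condition A with constant ζ = 2k − 1 and Condition B with constant ζ = 2k − 1. -/

import Mathlib

namespace GarsideOrder

variable {G : Type*} [Group G]

/-- `a ≤_R b` iff `b * a⁻¹ ∈ M`. -/
def leR (M : Submonoid G) (a b : G) : Prop := b * a⁻¹ ∈ M

/-- `a ≤_L b` iff `a⁻¹ * b ∈ M`. -/
def leL (M : Submonoid G) (a b : G) : Prop := a⁻¹ * b ∈ M

/-- Right divisors (in `M`) of `a`. -/
def DivR (M : Submonoid G) (a : G) : Set G := {b : G | b ∈ M ∧ leR M b a}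

/-- Left divisors (in `M`) of `a`. -/
def DivL (M : Submonoid G) (a : G) : Set G := {b : G | b ∈ M ∧ leL M b a}

/-- `a` is balanced if its sets of right and left divisors coincide. -/
def Balanced (M : Submonoid G) (a : G) : Prop := DivR M a = DivL M a

open Classical in
/-- The `N`-tail of `a`: the unique `b ∈ N` having the same right divisors lying in `N`
as `a` (w.r.t. the divisibility of the ambient monoid `M`). -/
noncomputable def tail (M N : Submonoid G) (a : G) : G :=
  if h : ∃ b : G, b ∈ N ∧
      {c : G | c ∈ N ∧ leR M c a} = {c : G | c ∈ N ∧ leR M c b} then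
    h.choose
  else 1

/-- Iterated stripping of alternating tails: first the `M₁`-tail, then the `N`-tail, etc. -/
noncomputable def strip (M M₁ N : Submonoid G) : ℕ → G → G
  | 0, a => a
  | i + 1, a =>
      strip M M₁ N i a *
        (tail M (if i % 2 = 0 then M₁ else N) (strip M M₁ N i a))⁻¹

/-- The breadth of `a`: the length of the alternating form of `a`, i.e. the least `p ≥ 1`
such that stripping alternating tails `p` times reaches `1`. -/
noncomputable def bh (M M₁ N : Submonoid G) (a : G) : ℕ :=
  sInf {p : ℕ | 1 ≤ p ∧ strip M M₁ N p a = 1}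

/-- The depth of `a`: `(bh a - 1)/2` if `bh a` is odd, `bh a / 2` if `bh a` is even;
in both cases this is `bh a / 2` with natural division. -/
noncomputable def dpt (M M₁ N : Submonoid G) (a : G) : ℕ := bh M M₁ N a / 2

/-- `a ∈ M` is unmovable if `Δ` does not right-divide it. -/
def Unmovable (M : Submonoid G) (Δ a : G) : Prop := a ∈ M ∧ ¬ leR M Δ a

/-- `α` is `(H, G₁)`-negative: its `Δ`-form is `a Δ^{-k}` with `k ≥ 1` and
`dpt a < dpt (Δ^k)`. -/
def Negative (M M₁ N : Submonoid G) (Δ : G) (α : G) : Prop :=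
  ∃ a : G, ∃ k : ℕ, Unmovable M Δ a ∧ 1 ≤ k ∧ α = a * (Δ ^ k)⁻¹ ∧
    dpt M M₁ N a < dpt M M₁ N (Δ ^ k)

/-- `α` is `(H, G₁)`-positive if `α⁻¹` is `(H, G₁)`-negative. -/
def Positive (M M₁ N : Submonoid G) (Δ : G) (α : G) : Prop :=
  Negative M M₁ N Δ α⁻¹

/-- The set `Θ` of theta elements `θ^k a₀`, `k ≥ 1`, `a₀ ∈ M₁`. -/
def thetaSet (M₁ : Submonoid G) (θ : G) : Set G :=
  {x : G | ∃ k : ℕ, 1 ≤ k ∧ ∃ a₀ ∈ M₁, x = θ ^ k * a₀}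

/-- `Θ̄ = Θ ∪ M₁`. -/
def thetaBar (M₁ : Submonoid G) (θ : G) : Set G := thetaSet M₁ θ ∪ (M₁ : Set G)

/-- Condition A with constant `ζ`: `dpt (Δ^k) = ζ k + 1` for all `k ≥ 1`. -/
def CondA (M M₁ N : Submonoid G) (Δ : G) (ζ : ℕ) : Prop :=
  ∀ k : ℕ, 1 ≤ k → dpt M M₁ N (Δ ^ k) = ζ * k + 1

/-- Condition B with constant `ζ`. -/
def CondB (M M₁ N : Submonoid G) (Δ θ : G) (ζ : ℕ) : Prop :=
  ∀ a b c : G, ∀ t : ℤ,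
    Unmovable M Δ a → Unmovable M Δ b →
    ¬(a ∈ thetaBar M₁ θ ∧ b ∈ thetaBar M₁ θ) →
    Unmovable M Δ c → a * b = c * Δ ^ t →
    ∃ ε : ℕ, ε ≤ 1 ∧
      (dpt M M₁ N c : ℤ) =
        (dpt M M₁ N a : ℤ) + (dpt M M₁ N b : ℤ) - (ζ : ℤ) * t - (ε : ℤ) ∧
      ((a ∈ thetaSet M₁ θ ∨ b ∈ thetaSet M₁ θ ∨ c ∈ M₁) → ε = 1)

/-- A Garside structure with group of fractions the subgroup `car`. -/
structure IsGarsideOn (car : Subgroup G) (M : Submonoid G) (Δ : G) : Prop where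
  M_sub : (M : Set G) ⊆ (car : Set G)
  delta_mem : Δ ∈ M
  units_trivial : ∀ x : G, x ∈ M → x⁻¹ ∈ M → x = 1
  noetherian : ∀ a ∈ M, ∃ n : ℕ, 1 ≤ n ∧ ∀ l : List G,
      (∀ x ∈ l, x ∈ M ∧ x ≠ 1) → l.prod = a → l.length ≤ n
  balanced : Balanced M Δ
  div_finite : (DivR M Δ).Finite
  div_gen_monoid : Submonoid.closure (DivR M Δ) = M
  div_gen_group : Subgroup.closure (DivR M Δ) = car
  meet : ∀ a ∈ car, ∀ b ∈ car, ∃ c ∈ car, leR M c a ∧ leR M c b ∧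
      ∀ d ∈ car, leR M d a → leR M d b → leR M d c
  join : ∀ a ∈ car, ∀ b ∈ car, ∃ c ∈ car, leR M a c ∧ leR M b c ∧
      ∀ d ∈ car, leR M a d → leR M b d → leR M c d

/-- The parabolic submonoid determined by `δ`: the submonoid generated by `Div(δ)`. -/
def parM (M : Submonoid G) (δ : G) : Submonoid G := Submonoid.closure (DivR M δ)

/-- The parabolic subgroup determined by `δ`: the subgroup generated by `Div(δ)`. -/
def parG (M : Submonoid G) (δ : G) : Subgroup G := Subgroup.closure (DivR M δ)

/-- `δ` determines a parabolic substructure of `(G, M, Δ)`. -/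
structure IsParabolic (M : Submonoid G) (Δ δ : G) : Prop where
  mem : δ ∈ M
  balanced : Balanced M δ
  div_eq : DivR M δ = DivR M Δ ∩ (parM M δ : Set G)

/-- The setting of Section 3: a Garside structure `(car, M, Δ)` together with two
parabolic substructures `(H, N, Λ)` (given by `lam`) and `(G₁, M₁, Δ₁)` (given by `δ1`),
with `N ≠ M`, `M₁ ≠ M`, `N ∪ M₁` generating `M`, `Δ` central, `Δ₁` central in `G₁`. -/
structure Setting (G : Type*) [Group G] where
  car : Subgroup G
  M : Submonoid G
  Δ : G
  δ1 : G
  lam : G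
  garside : IsGarsideOn car M Δ
  par1 : IsParabolic M Δ δ1
  parH : IsParabolic M Δ lam
  N_ne : parM M lam ≠ M
  M1_ne : parM M δ1 ≠ M
  unionGen : Submonoid.closure ((parM M lam : Set G) ∪ (parM M δ1 : Set G)) = M
  delta_central : ∀ g ∈ car, Δ * g = g * Δ
  delta1_central : ∀ g ∈ parG M δ1, δ1 * g = g * δ1

namespace Setting

variable (S : Setting G)

/-- The parabolic submonoid `M₁`. -/
def M₁ : Submonoid G := parM S.M S.δ1

/-- The parabolic submonoid `N`. -/
def Nsub : Submonoid G := parM S.M S.lam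

/-- The parabolic subgroup `G₁`. -/
def G₁ : Subgroup G := parG S.M S.δ1

/-- `θ = Δ Δ₁⁻¹`. -/
def theta : G := S.Δ * S.δ1⁻¹

/-- The set of `(H, G₁)`-negative elements. -/
def Neg : Set G := {α : G | Negative S.M S.M₁ S.Nsub S.Δ α}

/-- The set of `(H, G₁)`-positive elements. -/
def Pos : Set G := {α : G | α⁻¹ ∈ S.Neg}

/-- Condition A. -/
def condA (ζ : ℕ) : Prop := CondA S.M S.M₁ S.Nsub S.Δ ζ

/-- Condition B. -/
def condB (ζ : ℕ) : Prop := CondB S.M S.M₁ S.Nsub S.Δ S.theta ζ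

/-- `(H, G₁)` is a Dehornoy structure: `PP ⊆ P`, `G₁ P G₁ ⊆ P`, and the group is the
disjoint union of `P`, `P⁻¹` and `G₁`. -/
def IsDehornoy : Prop :=
  (∀ α ∈ S.Pos, ∀ β ∈ S.Pos, α * β ∈ S.Pos) ∧
  (∀ g₁ ∈ S.G₁, ∀ α ∈ S.Pos, ∀ g₂ ∈ S.G₁, g₁ * α * g₂ ∈ S.Pos) ∧
  (∀ α ∈ S.car, α ∈ S.Pos ∨ α ∈ S.Neg ∨ α ∈ S.G₁) ∧
  (∀ α : G, ¬(α ∈ S.Pos ∧ α ∈ S.Neg)) ∧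
  (∀ α : G, ¬(α ∈ S.Pos ∧ α ∈ S.G₁)) ∧
  (∀ α : G, ¬(α ∈ S.Neg ∧ α ∈ S.G₁))

end Setting

end GarsideOrder


namespace DihedralArtin

/-- The alternating word `x y x y ⋯` of length `m`. -/
def alt {α : Type*} [Monoid α] (x y : α) : ℕ → α
  | 0 => 1
  | k + 1 => x * alt y x k

/-- The defining relation of the Artin group of type `I₂(m)`:
`Π(s, t, m) = Π(t, s, m)`, with `s = of true` and `t = of false`. -/
def dihedralRel (m : ℕ) : Set (FreeGroup Bool) :=
  {alt (FreeGroup.of true) (FreeGroup.of false) m *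
    (alt (FreeGroup.of false) (FreeGroup.of true) m)⁻¹}

/-- The Artin group of type `I₂(m)`. -/
abbrev DG (m : ℕ) := PresentedGroup (dihedralRel m)

/-- The generator `s`. -/
def sA (m : ℕ) : DG m := PresentedGroup.of true

/-- The generator `t`. -/
def tA (m : ℕ) : DG m := PresentedGroup.of false

/-- The Artin monoid: the submonoid generated by `{s, t}`. -/
def Md (m : ℕ) : Submonoid (DG m) := Submonoid.closure {sA m, tA m}

/-- The submonoid generated by `t`. -/
def M₁d (m : ℕ) : Submonoid (DG m) := Submonoid.closure {tA m}

/-- The submonoid generated by `s`. -/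
def Nd (m : ℕ) : Submonoid (DG m) := Submonoid.closure {sA m}

/-- The subgroup generated by `t`. -/
def G₁d (m : ℕ) : Subgroup (DG m) := Subgroup.closure {tA m}

/-- The subgroup generated by `s`. -/
def Hd (m : ℕ) : Subgroup (DG m) := Subgroup.closure {sA m}

/-- `Ω = Π(s, t, m)` in the Artin group of type `I₂(m)`. -/
def Ωd (m : ℕ) : DG m := alt (sA m) (tA m) m

end DihedralArtin

namespace DihedralArtin

open GarsideOrder Matrix

/-! ### The values `sin (n π / m) / sin (π / m)` -/

/-- The value at `2 cos (π / m)` of the `(n - 1)`-st Chebyshev polynomial of the second kind. -/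
noncomputable def cheb (m n : ℕ) : ℝ :=
  Real.sin (n * (Real.pi / m)) / Real.sin (Real.pi / m)

theorem sin_pi_div_pos {m : ℕ} (hm : 2 ≤ m) : 0 < Real.sin (Real.pi / m) := by
  have h : (2 : ℝ) ≤ m := by exact_mod_cast hm
  apply Real.sin_pos_of_pos_of_lt_pi
  · have := Real.pi_pos
    positivity
  · rw [div_lt_iff₀ (by linarith)]
    nlinarith [Real.pi_pos]

theorem cheb_zero (m : ℕ) : cheb m 0 = 0 := by simp [cheb]

theorem cheb_one {m : ℕ} (hm : 2 ≤ m) : cheb m 1 = 1 := by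
  simp [cheb, (sin_pi_div_pos hm).ne']

theorem cheb_add_two {m : ℕ} (hm : 2 ≤ m) (n : ℕ) :
    cheb m (n + 2) = cheb m 2 * cheb m (n + 1) - cheb m n := by
  have h := (sin_pi_div_pos hm).ne'
  unfold cheb
  set x := Real.pi / m
  have h2 : Real.sin ((2 : ℕ) * x) / Real.sin x = 2 * Real.cos x := by
    push_cast
    rw [Real.sin_two_mul]
    field_simp
  have hadd : Real.sin ((n + 2 : ℕ) * x) + Real.sin (n * x)
      = 2 * Real.cos x * Real.sin ((n + 1 : ℕ) * x) := by
    have e1 : ((n + 2 : ℕ) : ℝ) * x = (n + 1 : ℕ) * x + x := by push_cast; ring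
    have e2 : (n : ℝ) * x = (n + 1 : ℕ) * x - x := by push_cast; ring
    rw [e1, e2, Real.sin_add, Real.sin_sub]
    ring
  rw [h2, eq_sub_iff_add_eq, ← add_div, hadd, mul_div_assoc]

theorem cheb_self {m : ℕ} (hm : 2 ≤ m) : cheb m m = 0 := by
  have : (m : ℝ) ≠ 0 := by positivity
  unfold cheb
  rw [mul_div_cancel₀ _ this]
  simp

theorem cheb_pred {n : ℕ} (hm : 2 ≤ n + 1) : cheb (n + 1) n = 1 := by
  have h := (sin_pi_div_pos hm).ne'
  have : (n : ℝ) * (Real.pi / (n + 1 : ℕ)) = Real.pi - Real.pi / (n + 1 : ℕ) := by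
    push_cast
    field_simp
    ring
  unfold cheb
  rw [this, Real.sin_pi_sub, div_self h]

theorem cheb_pos {m n : ℕ} (h0 : 0 < n) (hn : n < m) : 0 < cheb m n := by
  have hm : 2 ≤ m := by omega
  have hn' : (n : ℝ) < m := by exact_mod_cast hn
  have h0' : (0 : ℝ) < n := by exact_mod_cast h0
  have hπ := Real.pi_pos
  refine div_pos (Real.sin_pos_of_pos_of_lt_pi (by positivity) ?_) (sin_pi_div_pos hm)
  rw [← mul_div_assoc, div_lt_iff₀ (by linarith)]
  nlinarith

theorem cheb_nonneg {m n : ℕ} (hm : 2 ≤ m) (hn : n ≤ m) : 0 ≤ cheb m n := by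
  rcases Nat.eq_zero_or_pos n with rfl | h0
  · rw [cheb_zero]
  · rcases hn.eq_or_lt with rfl | h
    · rw [cheb_self hm]
    · exact (cheb_pos h0 h).le

/-! ### The orientation cocycle on `SL(2, ℝ)` and its central extension -/

/-- Real unimodular matrices of size two. -/
abbrev SL2 := SpecialLinearGroup (Fin 2) ℝ

/-- The lower left entry; it vanishes exactly when the matrix fixes the point at infinity. -/
def low (A : SL2) : ℝ := A.1 1 0

/-- The orientation cocycle. -/
noncomputable def orient (A B : SL2) : ℤ :=
  (SignType.sign (low A * low B * low (A * B)) : SignType)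

theorem low_one : low 1 = 0 := by simp [low]

theorem low_mul (A B : SL2) : low (A * B) = low A * B.1 0 0 + A.1 1 1 * low B := by
  simp [low, Matrix.mul_apply, Fin.sum_univ_two]

theorem mul_apply_one_one (A B : SL2) :
    (A * B).1 1 1 = A.1 1 0 * B.1 0 1 + A.1 1 1 * B.1 1 1 := by
  simp [Matrix.mul_apply, Fin.sum_univ_two]

theorem det_eq (A : SL2) : A.1 0 0 * A.1 1 1 - A.1 0 1 * A.1 1 0 = 1 := by
  have := A.2
  rwa [Matrix.det_fin_two] at this

theorem orient_eq_zero_left {A : SL2} (h : low A = 0) (B : SL2) : orient A B = 0 := by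
  simp [orient, h]

theorem orient_eq_zero_right {B : SL2} (h : low B = 0) (A : SL2) : orient A B = 0 := by
  simp [orient, h]

theorem orient_eq_zero_mul {A B : SL2} (h : low (A * B) = 0) : orient A B = 0 := by
  simp [orient, h]

theorem low_zero_transitive (A B : SL2) :
    (low A = 0 → low B = 0 → low (A * B) = 0) ∧
    (low A = 0 → low (A * B) = 0 → low B = 0) ∧
    (low B = 0 → low (A * B) = 0 → low A = 0) := by
  have hA := det_eq A
  have hB := det_eq B
  rw [low_mul]
  unfold low
  refine ⟨fun h1 h2 => by simp [h1, h2], fun h1 h2 => ?_, fun h1 h2 => ?_⟩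
  · rw [h1] at h2 hA
    have : A.1 1 1 ≠ 0 := by
      rintro h
      simp [h] at hA
    simpa [this] using h2
  · rw [h1] at h2 hB
    have : B.1 0 0 ≠ 0 := by
      rintro h
      simp [h] at hB
    simpa [this] using h2

theorem low_plucker (A B C : SL2) :
    low A * low C + -(low (A * B) * low (B * C)) + low (A * B * C) * low B = 0 := by
  have hB := det_eq B
  rw [low_mul (A * B) C, low_mul A B, low_mul B C]
  rw [mul_apply_one_one]
  unfold low
  linear_combination (-(A.1 1 0 * C.1 1 0)) * hB

theorem sign_of_sum_eq_zero {x y z : ℝ} (h : x + y + z = 0) :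
    (0 ≤ SignType.sign x → 0 ≤ SignType.sign y → 0 ≤ SignType.sign z →
      SignType.sign x = 0 ∧ SignType.sign y = 0 ∧ SignType.sign z = 0) ∧
    (SignType.sign x ≤ 0 → SignType.sign y ≤ 0 → SignType.sign z ≤ 0 →
      SignType.sign x = 0 ∧ SignType.sign y = 0 ∧ SignType.sign z = 0) := by
  simp only [sign_nonneg_iff, sign_nonpos_iff, sign_eq_zero_iff]
  constructor <;> intro h1 h2 h3 <;> refine ⟨?_, ?_, ?_⟩ <;> linarith

set_option maxRecDepth 100000 in
set_option synthInstance.maxHeartbeats 400000 in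
set_option synthInstance.maxSize 2000 in
set_option maxHeartbeats 1000000 in
theorem signType_cocycle : ∀ a b c ab bc abc : SignType,
    ((a = 0 → b = 0 → ab = 0) ∧ (a = 0 → ab = 0 → b = 0) ∧ (b = 0 → ab = 0 → a = 0)) →
    ((b = 0 → c = 0 → bc = 0) ∧ (b = 0 → bc = 0 → c = 0) ∧ (c = 0 → bc = 0 → b = 0)) →
    ((ab = 0 → c = 0 → abc = 0) ∧ (ab = 0 → abc = 0 → c = 0) ∧ (c = 0 → abc = 0 → ab = 0)) →
    ((a = 0 → bc = 0 → abc = 0) ∧ (a = 0 → abc = 0 → bc = 0) ∧ (bc = 0 → abc = 0 → a = 0)) →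
    ((0 ≤ a * c → 0 ≤ -(ab * bc) → 0 ≤ abc * b →
        a * c = 0 ∧ -(ab * bc) = 0 ∧ abc * b = 0) ∧
      (a * c ≤ 0 → -(ab * bc) ≤ 0 → abc * b ≤ 0 →
        a * c = 0 ∧ -(ab * bc) = 0 ∧ abc * b = 0)) →
    ((a * b * ab : SignType) : ℤ) + ((ab * c * abc : SignType) : ℤ) =
      ((b * c * bc : SignType) : ℤ) + ((a * bc * abc : SignType) : ℤ) := by
  decide

theorem orient_cocycle (A B C : SL2) :
    orient A B + orient (A * B) C = orient B C + orient A (B * C) := by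
  have h := sign_of_sum_eq_zero (low_plucker A B C)
  have h1 := low_zero_transitive A B
  have h2 := low_zero_transitive B C
  have h3 := low_zero_transitive (A * B) C
  have h4 := low_zero_transitive A (B * C)
  rw [← mul_assoc] at h4
  simp only [← sign_eq_zero_iff (α := ℝ)] at h1 h2 h3 h4
  simp only [Left.sign_neg, sign_mul] at h
  unfold orient
  rw [← mul_assoc]
  simp only [sign_mul]
  exact signType_cocycle _ _ _ _ _ _ h1 h2 h3 h4 h

/-- The central extension of `SL(2, ℝ)` by `ℤ` given by the orientation cocycle. -/
@[ext]
structure Ext where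
  /-- The integral coordinate. -/
  ht : ℤ
  /-- The projection to `SL(2, ℝ)`. -/
  mat : SL2

namespace Ext

noncomputable instance : Mul Ext := ⟨fun x y => ⟨x.ht + y.ht + orient x.mat y.mat, x.mat * y.mat⟩⟩

instance : One Ext := ⟨⟨0, 1⟩⟩

noncomputable instance : Inv Ext := ⟨fun x => ⟨-x.ht, x.mat⁻¹⟩⟩

@[simp] theorem ht_mul (x y : Ext) : (x * y).ht = x.ht + y.ht + orient x.mat y.mat := rfl
@[simp] theorem mat_mul (x y : Ext) : (x * y).mat = x.mat * y.mat := rfl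
@[simp] theorem ht_one : (1 : Ext).ht = 0 := rfl
@[simp] theorem mat_one : (1 : Ext).mat = 1 := rfl
@[simp] theorem ht_inv (x : Ext) : x⁻¹.ht = -x.ht := rfl
@[simp] theorem mat_inv (x : Ext) : x⁻¹.mat = x.mat⁻¹ := rfl

noncomputable instance : Group Ext :=
  Group.ofLeftAxioms
    (fun x y z => by
      ext1
      · have := orient_cocycle x.mat y.mat z.mat
        simp only [ht_mul, mat_mul]
        linarith
      · simp [mul_assoc])
    (fun x => by
      ext1
      · simp [orient_eq_zero_left low_one]
      · simp)
    (fun x => by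
      ext1
      · simp [orient_eq_zero_mul (A := x.mat⁻¹) (B := x.mat) (by simp [low_one])]
      · simp)

end Ext

/-! ### The lift of the reflection representation to the extension -/

/-- The image of `s` in `SL(2, ℝ)`. -/
noncomputable def matS (m : ℕ) : SL2 := ⟨!![1, 0; -cheb m 2, 1], by simp⟩

/-- The image of `t` in `SL(2, ℝ)`. -/
noncomputable def matT (m : ℕ) : SL2 := ⟨!![1, cheb m 2; 0, 1], by simp⟩

/-- The images of the generators in the extension. -/
noncomputable def extGen (m : ℕ) : Bool → Ext
  | true => ⟨1, matS m⟩
  | false => ⟨0, matT m⟩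

theorem alt_odd {α : Type*} [Monoid α] (x y : α) (n : ℕ) :
    alt x y (2 * n + 1) = (x * y) ^ n * x := by
  induction n with
  | zero => simp [alt]
  | succ n ih =>
    rw [show 2 * (n + 1) + 1 = 2 * n + 1 + 1 + 1 by ring, alt, alt, ih, pow_succ']
    simp only [mul_assoc]

theorem map_alt {α β : Type*} [Monoid α] [Monoid β] (f : α →* β) (x y : α) (n : ℕ) :
    f (alt x y n) = alt (f x) (f y) n := by
  induction n generalizing x y with
  | zero => simp [alt]
  | succ n ih => simp [alt, ih]

theorem coe_mul_eq {A B : SL2} {a b c d a' b' c' d' : ℝ} (hA : A.1 = !![a, b; c, d])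
    (hB : B.1 = !![a', b'; c', d']) :
    (A * B).1 = !![a * a' + b * c', a * b' + b * d'; c * a' + d * c', c * b' + d * d'] := by
  change A.1 * B.1 = _
  rw [hA, hB, Matrix.mul_fin_two]

theorem matrix_ext_two {a b c d a' b' c' d' : ℝ} (ha : a = a') (hb : b = b') (hc : c = c')
    (hd : d = d') : !![a, b; c, d] = !![a', b'; c', d'] := by
  rw [ha, hb, hc, hd]

theorem low_eq {A : SL2} {a b c d : ℝ} (hA : A.1 = !![a, b; c, d]) : low A = c := by
  simp [low, hA]

theorem neg_one_pow_mul_self (n : ℕ) : ((-1 : ℝ) ^ n) * (-1) ^ n = 1 := by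
  rw [← mul_pow]; simp

theorem extGen_ts_pow {m : ℕ} (n : ℕ) (hn : 2 * n + 2 < m) :
    ((extGen m false * extGen m true) ^ (n + 1)).ht = 2 * n + 1 ∧
    ((extGen m false * extGen m true) ^ (n + 1)).mat.1 =
      !![(-1) ^ (n + 1) * cheb m (2 * n + 3), (-1) ^ n * cheb m (2 * n + 2);
        (-1) ^ (n + 1) * cheb m (2 * n + 2), (-1) ^ n * cheb m (2 * n + 1)] := by
  have hm : 2 ≤ m := by omega
  have e3 := cheb_add_two hm 1
  rw [cheb_one hm] at e3
  have base : (extGen m false * extGen m true).mat.1 =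
      !![1 - cheb m 2 ^ 2, cheb m 2; -cheb m 2, 1] := by
    rw [Ext.mat_mul, coe_mul_eq (A := (extGen m false).mat) (B := (extGen m true).mat) rfl rfl]
    apply matrix_ext_two <;> ring
  induction n with
  | zero =>
    simp only [zero_add, pow_one]
    refine ⟨?_, ?_⟩
    · rw [Ext.ht_mul, orient_eq_zero_left (by simp [low, extGen, matT])]
      simp [extGen]
    · rw [base]
      norm_num [cheb_one hm]
      linarith
  | succ n ih =>
    obtain ⟨ih1, ih2⟩ := ih (by omega)
    have r1 := cheb_add_two hm (2 * n + 1)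
    have r2 := cheb_add_two hm (2 * n + 2)
    have r3 := cheb_add_two hm (2 * n + 3)
    rw [show 2 * n + 1 + 2 = 2 * n + 3 by ring, show 2 * n + 1 + 1 = 2 * n + 2 by ring] at r1
    rw [show 2 * n + 2 + 2 = 2 * n + 4 by ring, show 2 * n + 2 + 1 = 2 * n + 3 by ring] at r2
    rw [show 2 * n + 3 + 2 = 2 * n + 5 by ring, show 2 * n + 3 + 1 = 2 * n + 4 by ring] at r3
    have key : ((extGen m false * extGen m true) ^ (n + 1 + 1)).mat.1 =
      !![(-1) ^ (n + 1 + 1) * cheb m (2 * (n + 1) + 3), (-1) ^ (n + 1) * cheb m (2 * (n + 1) + 2);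
        (-1) ^ (n + 1 + 1) * cheb m (2 * (n + 1) + 2),
        (-1) ^ (n + 1) * cheb m (2 * (n + 1) + 1)] := by
      rw [pow_succ, Ext.mat_mul, coe_mul_eq ih2 base,
        show 2 * (n + 1) + 3 = 2 * n + 5 by ring, show 2 * (n + 1) + 2 = 2 * n + 4 by ring,
        show 2 * (n + 1) + 1 = 2 * n + 3 by ring, r3, r2, r1]
      apply matrix_ext_two <;> ring
    refine ⟨?_, key⟩
    have p1 := cheb_pos (m := m) (n := 2 * n + 2) (by omega) (by omega)
    have p2 := cheb_pos (m := m) (n := 2 * (n + 1) + 2) (by omega) (by omega)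
    have p3 := cheb_pos (m := m) (n := 2) (by omega) (by omega)
    have : orient ((extGen m false * extGen m true) ^ (n + 1)).mat
        (extGen m false * extGen m true).mat = 1 := by
      unfold orient
      rw [← Ext.mat_mul, ← pow_succ, low_eq key, low_eq ih2, low_eq base, sign_pos]
      · rfl
      · have := neg_one_pow_mul_self n
        have e : (-1 : ℝ) ^ (n + 1) * cheb m (2 * n + 2) * -cheb m 2 *
            ((-1) ^ (n + 1 + 1) * cheb m (2 * (n + 1) + 2)) =
            ((-1) ^ n * (-1) ^ n) * (cheb m (2 * n + 2) * cheb m 2 * cheb m (2 * (n + 1) + 2)) := by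
          ring
        rw [e, this]
        positivity
    rw [pow_succ, Ext.ht_mul, this, ih1, Ext.ht_mul,
      orient_eq_zero_left (by simp [low, extGen, matT])]
    simp [extGen]
    ring

theorem extGen_braid {k : ℕ} (hk : 1 ≤ k) :
    extGen (2 * k + 1) true * (extGen (2 * k + 1) false * extGen (2 * k + 1) true) ^ k =
      (extGen (2 * k + 1) false * extGen (2 * k + 1) true) ^ k * extGen (2 * k + 1) false := by
  obtain ⟨n, rfl⟩ : ∃ n, k = n + 1 := ⟨k - 1, by omega⟩
  obtain ⟨-, h⟩ := extGen_ts_pow (m := 2 * (n + 1) + 1) n (by omega)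
  have hm : 2 ≤ 2 * (n + 1) + 1 := by omega
  have r := cheb_add_two hm (2 * n + 1)
  have u3 := cheb_self hm
  have u2 := cheb_pred hm
  rw [show 2 * n + 1 + 2 = 2 * (n + 1) + 1 by ring, show 2 * n + 1 + 1 = 2 * (n + 1) by ring,
    u3, u2] at r
  rw [show 2 * n + 3 = 2 * (n + 1) + 1 by ring, show 2 * n + 2 = 2 * (n + 1) by ring, u3, u2] at h
  have pos := cheb_pos (m := 2 * (n + 1) + 1) (n := 2) (by omega) (by omega)
  set m := 2 * (n + 1) + 1
  set X := (extGen m false * extGen m true) ^ (n + 1)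
  have e1 : (extGen m true * X).mat.1 = !![0, (-1) ^ n; (-1) ^ (n + 1), 0] := by
    rw [Ext.mat_mul, coe_mul_eq (A := (extGen m true).mat) rfl h]
    apply matrix_ext_two
    · ring
    · ring
    · ring
    · linear_combination (-1) ^ n * r
  have e2 : (X * extGen m false).mat.1 = !![0, (-1) ^ n; (-1) ^ (n + 1), 0] := by
    rw [Ext.mat_mul, coe_mul_eq (B := (extGen m false).mat) h rfl]
    apply matrix_ext_two
    · ring
    · ring
    · ring
    · linear_combination (-1) ^ n * r
  refine Ext.ext ?_ (Subtype.ext (e1.trans e2.symm))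
  have o : orient (extGen m true).mat X.mat = -1 := by
    unfold orient
    rw [← Ext.mat_mul, low_eq e1, low_eq h,
      low_eq (A := (extGen m true).mat) (a := 1) (b := 0) (c := -cheb m 2) (d := 1) rfl, sign_neg]
    · rfl
    · have e : -cheb m 2 * ((-1) ^ (n + 1) * 1) * (-1) ^ (n + 1) =
          -cheb m 2 * ((-1) ^ (n + 1) * (-1) ^ (n + 1)) := by ring
      rw [e, neg_one_pow_mul_self]
      linarith
  rw [Ext.ht_mul, Ext.ht_mul, o, orient_eq_zero_right (by simp [low, extGen, matT])]
  simp [extGen]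

/-- The lift to the extension of the reflection representation. -/
noncomputable def lift {k : ℕ} (hk : 1 ≤ k) : DG (2 * k + 1) →* Ext :=
  PresentedGroup.toGroup (f := extGen (2 * k + 1)) (by
    intro r hr
    rw [dihedralRel, Set.mem_singleton_iff] at hr
    rw [hr, map_mul, map_inv, map_alt, map_alt, FreeGroup.lift_apply_of,
      FreeGroup.lift_apply_of, alt_odd, alt_odd, ← extGen_braid hk, ← mul_pow_mul, mul_inv_cancel])

/-- The generators `s = gen m true` and `t = gen m false`. -/
def gen (m : ℕ) (l : Bool) : DG m := PresentedGroup.of l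

theorem gen_mem (m : ℕ) (l : Bool) : gen m l ∈ Md m :=
  Submonoid.subset_closure (by cases l; exacts [Or.inr rfl, Or.inl rfl])

theorem lift_gen {k : ℕ} (hk : 1 ≤ k) (l : Bool) :
    lift hk (gen (2 * k + 1) l) = extGen (2 * k + 1) l :=
  PresentedGroup.toGroup.of _

/-- The integral coordinate of the lift. -/
noncomputable def height {k : ℕ} (hk : 1 ≤ k) (u : DG (2 * k + 1)) : ℤ := (lift hk u).ht

/-- The opposite of the lower left entry of the matrix of `u`. -/
noncomputable def xc {k : ℕ} (hk : 1 ≤ k) (u : DG (2 * k + 1)) : ℝ := -low (lift hk u).mat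

/-- The lower right entry of the matrix of `u`. -/
noncomputable def yc {k : ℕ} (hk : 1 ≤ k) (u : DG (2 * k + 1)) : ℝ := (lift hk u).mat.1 1 1

section Coordinates

variable {k : ℕ} (hk : 1 ≤ k) (u v : DG (2 * k + 1))

theorem height_mul : height hk (u * v) =
    height hk u + height hk v - (SignType.sign (xc hk u * xc hk v * xc hk (u * v)) : SignType) := by
  have : xc hk u * xc hk v * xc hk (u * v) =
      -(low (lift hk u).mat * low (lift hk v).mat * low ((lift hk u).mat * (lift hk v).mat)) := by
    simp only [xc, map_mul, Ext.mat_mul]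
    ring
  rw [this, Left.sign_neg, SignType.coe_neg]
  simp [height, orient]

theorem height_one : height hk 1 = 0 := by simp [height]

theorem xc_one : xc hk 1 = 0 := by simp [xc, low_one]

theorem yc_one : yc hk 1 = 1 := by simp [yc]

theorem xc_s : xc hk (gen _ true) = cheb (2 * k + 1) 2 := by
  simp [xc, lift_gen, extGen, low, matS]

theorem xc_t : xc hk (gen _ false) = 0 := by
  simp [xc, lift_gen, extGen, low, matT]

theorem height_s : height hk (gen _ true) = 1 := by
  simp [height, lift_gen, extGen]

theorem height_t : height hk (gen _ false) = 0 := by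
  simp [height, lift_gen, extGen]

theorem xc_mul_s : xc hk (u * gen _ true) = xc hk u + cheb (2 * k + 1) 2 * yc hk u := by
  rw [xc, xc, yc, map_mul, lift_gen, Ext.mat_mul, low_mul]
  simp [extGen, low, matS]
  ring

theorem yc_mul_s : yc hk (u * gen _ true) = yc hk u := by
  rw [yc, yc, map_mul, lift_gen, Ext.mat_mul, mul_apply_one_one]
  simp [extGen, matS]

theorem xc_mul_t : xc hk (u * gen _ false) = xc hk u := by
  rw [xc, xc, map_mul, lift_gen, Ext.mat_mul, low_mul]
  simp [extGen, low, matT]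

theorem yc_mul_t : yc hk (u * gen _ false) = yc hk u - cheb (2 * k + 1) 2 * xc hk u := by
  rw [yc, yc, xc, map_mul, lift_gen, Ext.mat_mul, mul_apply_one_one]
  simp [extGen, low, matT]
  ring

theorem height_mul_t : height hk (u * gen _ false) = height hk u := by
  rw [height_mul, xc_t, height_t]
  simp

theorem height_mul_s : height hk (u * gen _ true) =
    height hk u + 1 - (SignType.sign (xc hk u * xc hk (u * gen _ true)) : SignType) := by
  have h : 0 < cheb (2 * k + 1) 2 := cheb_pos (by omega) (by omega)
  rw [height_mul, height_s, xc_s, mul_right_comm, sign_mul _ (cheb _ _), sign_pos h, mul_one]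

end Coordinates

/-! ### Words without long alternating factors -/

/-- The alternating word of length `n` ending with the letter `l`. -/
def endAlt (m : ℕ) : Bool → ℕ → DG m
  | _, 0 => 1
  | l, n + 1 => endAlt m (!l) n * gen m l

theorem endAlt_two_mul (m : ℕ) (l : Bool) (n : ℕ) :
    endAlt m l (2 * n) = (gen m (!l) * gen m l) ^ n := by
  induction n with
  | zero => simp [endAlt]
  | succ n ih =>
    rw [show 2 * (n + 1) = 2 * n + 1 + 1 by ring, endAlt, endAlt, Bool.not_not, ih, pow_succ,
      mul_assoc]

theorem dihedral_relation (m : ℕ) : alt (sA m) (tA m) m = alt (tA m) (sA m) m := by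
  have h : PresentedGroup.mk (dihedralRel m)
      (alt (FreeGroup.of true) (FreeGroup.of false) m *
        (alt (FreeGroup.of false) (FreeGroup.of true) m)⁻¹) = 1 :=
    PresentedGroup.one_of_mem rfl
  rwa [map_mul, map_inv, mul_inv_eq_one, map_alt, map_alt] at h

theorem endAlt_self (k : ℕ) (l : Bool) : endAlt (2 * k + 1) l (2 * k + 1) = Ωd (2 * k + 1) := by
  rw [endAlt, endAlt_two_mul, Bool.not_not]
  cases l
  · exact (alt_odd (tA (2 * k + 1)) (sA (2 * k + 1)) k).symm.trans (dihedral_relation _).symm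
  · exact (alt_odd (sA (2 * k + 1)) (tA (2 * k + 1)) k).symm

theorem endAlt_mul_gen (k : ℕ) (l : Bool) :
    endAlt (2 * k + 1) (!l) (2 * k) * gen _ l = Ωd (2 * k + 1) :=
  endAlt_self k l

theorem gen_mul_endAlt (k : ℕ) (l : Bool) :
    gen _ l * endAlt (2 * k + 1) l (2 * k) = Ωd (2 * k + 1) := by
  rw [← endAlt_mul_gen k l, endAlt_two_mul, endAlt_two_mul, Bool.not_not, mul_pow_mul]

theorem gen_mul_omega (k : ℕ) (l : Bool) :
    gen _ l * Ωd (2 * k + 1) = Ωd (2 * k + 1) * gen _ (!l) := by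
  have h := endAlt_mul_gen k (!l)
  rw [Bool.not_not] at h
  nth_rw 1 [← h]
  rw [← mul_assoc, gen_mul_endAlt]

theorem gen_pow_mul_omega (k : ℕ) (l : Bool) (n : ℕ) :
    gen _ l ^ n * Ωd (2 * k + 1) = Ωd (2 * k + 1) * gen _ (!l) ^ n := by
  induction n with
  | zero => simp
  | succ n ih => rw [pow_succ, mul_assoc, gen_mul_omega, ← mul_assoc, ih, mul_assoc, ← pow_succ]

/-- The element `θ = Δ Δ₁⁻¹`. -/
abbrev theta (k : ℕ) : DG (2 * k + 1) := Ωd (2 * k + 1) ^ 2 * (tA (2 * k + 1) ^ 2)⁻¹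

theorem theta_eq (k : ℕ) :
    endAlt (2 * k + 1) false (2 * k) * endAlt (2 * k + 1) true (2 * k) = theta k := by
  have h1 : endAlt (2 * k + 1) true (2 * k) = Ωd (2 * k + 1) * (gen _ false)⁻¹ :=
    eq_mul_inv_of_mul_eq (endAlt_mul_gen k false)
  have h2 : endAlt (2 * k + 1) false (2 * k) = Ωd (2 * k + 1) * (gen _ true)⁻¹ :=
    eq_mul_inv_of_mul_eq (endAlt_mul_gen k true)
  have h3 : (gen _ true)⁻¹ * Ωd (2 * k + 1) = Ωd (2 * k + 1) * (gen _ false)⁻¹ := by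
    rw [inv_mul_eq_iff_eq_mul, ← mul_assoc, gen_mul_omega, mul_assoc]
    simp
  rw [h1, h2, theta, show tA (2 * k + 1) = gen _ false from rfl, mul_assoc, ← mul_assoc _ (Ωd _),
    h3]
  simp only [pow_two, _root_.mul_inv_rev, mul_assoc]

/-- `Reduced k l j p u d` holds when `u` is given by a word whose alternating factors have length
less than `2 * k + 1`, which ends with the letter `l`, has `d` maximal factors `s ⋯ s`, and whose
longest alternating suffix has length `j + 1`, the word before this suffix giving `p`. -/
inductive Reduced (k : ℕ) : Bool → ℕ → DG (2 * k + 1) → DG (2 * k + 1) → ℕ → Prop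
  | single (l : Bool) : Reduced k l 0 1 (gen _ l) (if l then 1 else 0)
  | same {l j p u d} : Reduced k l j p u d → Reduced k l 0 u (u * gen _ l) d
  | switch {l j p u d} : Reduced k l j p u d → j + 2 < 2 * k + 1 →
      Reduced k (!l) (j + 1) p (u * gen _ (!l)) (if l then d else d + 1)

namespace Reduced

theorem eq_mul_endAlt {k : ℕ} {l j p u d} (h : Reduced k l j p u d) :
    u = p * endAlt _ l (j + 1) := by
  induction h with
  | single l => simp [endAlt]
  | same h ih => simp [endAlt]
  | switch h hj ih => rw [endAlt, Bool.not_not, ih, mul_assoc]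

theorem lt {k : ℕ} (hk : 1 ≤ k) {l j p u d} (h : Reduced k l j p u d) : j + 1 < 2 * k + 1 := by
  induction h with
  | single l => omega
  | same h ih => omega
  | switch h hj ih => omega

theorem mem {k : ℕ} {l j p u d} (h : Reduced k l j p u d) :
    p ∈ Md (2 * k + 1) ∧ u ∈ Md (2 * k + 1) := by
  induction h with
  | single l => exact ⟨one_mem _, gen_mem _ _⟩
  | same h ih => exact ⟨ih.2, mul_mem ih.2 (gen_mem _ _)⟩
  | switch h hj ih => exact ⟨ih.1, mul_mem ih.2 (gen_mem _ _)⟩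

end Reduced

/-- The prefixes whose matrix fixes an axis: those which can precede a longest alternating suffix
starting with the letter `l` and moving it back to an axis. -/
def Axial (k : ℕ) : Bool → DG (2 * k + 1) → Prop
  | true, p => ∃ n : ℕ, p = theta k ^ n
  | false, p => ∃ n : ℕ, p = theta k ^ n * endAlt _ false (2 * k)

/-- The larger coordinate after an alternating word of length `j + 1`. -/
noncomputable def major (k : ℕ) (a b : ℝ) (j : ℕ) : ℝ :=
  a * cheb (2 * k + 1) (j + 2) + b * cheb (2 * k + 1) (j + 1)

/-- The smaller coordinate after an alternating word of length `j + 1`. -/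
noncomputable def minor (k : ℕ) (a b : ℝ) (j : ℕ) : ℝ :=
  a * cheb (2 * k + 1) (j + 1) + b * cheb (2 * k + 1) j

/-- The position of the row of `u` relative to the axes, and its height. -/
structure Position {k : ℕ} (hk : 1 ≤ k) (l : Bool) (j : ℕ) (p u : DG (2 * k + 1)) (d : ℕ)
    (e a b : ℝ) : Prop where
  sq_eq : e * e = 1
  a_nonneg : 0 ≤ a
  b_nonneg : 0 ≤ b
  nondeg : 0 < a ∨ (0 < b ∧ (j = 0 → l = false ∧ d = 0))
  xc_eq : xc hk u = if l then e * major k a b j else e * minor k a b j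
  yc_eq : yc hk u = if l then e * minor k a b j else -(e * major k a b j)
  axial : b = 0 → Axial k (l ^^ j.bodd) p
  height_s : l = true → 0 < major k a b j → height hk u = 2 * d - 1
  height_s_zero : l = true → major k a b j = 0 → height hk u = 2 * d - 2
  height_t : l = false → 0 < minor k a b j → height hk u = 2 * d - 1
  height_t_zero : l = false → minor k a b j = 0 → height hk u = 0

theorem minor_succ (k : ℕ) (a b : ℝ) (j : ℕ) : minor k a b (j + 1) = major k a b j := rfl

theorem major_succ {k : ℕ} (hk : 1 ≤ k) (a b : ℝ) (j : ℕ) :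
    major k a b (j + 1) = cheb (2 * k + 1) 2 * major k a b j - minor k a b j := by
  have hm : 2 ≤ 2 * k + 1 := by omega
  have h1 := cheb_add_two hm (j + 1)
  have h2 := cheb_add_two hm j
  unfold major minor
  rw [h1, h2]
  ring

theorem minor_zero {k : ℕ} (hk : 1 ≤ k) (a b : ℝ) : minor k a b 0 = a := by
  simp [minor, cheb_zero, cheb_one (show 2 ≤ 2 * k + 1 by omega)]

theorem major_zero {k : ℕ} (hk : 1 ≤ k) (a b : ℝ) :
    major k a b 0 = a * cheb (2 * k + 1) 2 + b := by
  simp [major, cheb_one (show 2 ≤ 2 * k + 1 by omega)]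

namespace Position

variable {k : ℕ} {hk : 1 ≤ k} {l : Bool} {j : ℕ} {p u : DG (2 * k + 1)} {d : ℕ} {e a b : ℝ}

theorem major_pos (P : Position hk l j p u d e a b) (hj : j + 2 < 2 * k + 1) :
    0 < major k a b j := by
  have h1 := cheb_pos (m := 2 * k + 1) (n := j + 2) (by omega) hj
  have h2 := cheb_pos (m := 2 * k + 1) (n := j + 1) (by omega) (by omega)
  have ha := P.a_nonneg
  have hb := P.b_nonneg
  unfold major
  rcases P.nondeg with h | ⟨h, -⟩ <;> positivity

theorem major_nonneg (P : Position hk l j p u d e a b) (hj : j + 1 < 2 * k + 1) :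
    0 ≤ major k a b j := by
  have h1 := cheb_nonneg (m := 2 * k + 1) (n := j + 2) (by omega) hj
  have h2 := cheb_nonneg (m := 2 * k + 1) (n := j + 1) (by omega) hj.le
  have ha := P.a_nonneg
  have hb := P.b_nonneg
  unfold major
  positivity

theorem minor_nonneg (P : Position hk l j p u d e a b) (hj : j + 1 < 2 * k + 1) :
    0 ≤ minor k a b j := by
  have h1 := cheb_nonneg (m := 2 * k + 1) (n := j + 1) (by omega) hj.le
  have h2 := cheb_nonneg (m := 2 * k + 1) (n := j) (by omega) (by omega)
  have ha := P.a_nonneg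
  have hb := P.b_nonneg
  unfold minor
  positivity

theorem minor_pos_or (P : Position hk l j p u d e a b) (hj : j + 1 < 2 * k + 1) :
    0 < minor k a b j ∨ (minor k a b j = 0 ∧ 0 < b ∧ a = 0 ∧ j = 0 ∧ l = false ∧ d = 0) := by
  have h1 := cheb_pos (m := 2 * k + 1) (n := j + 1) (by omega) hj
  have h2 := cheb_nonneg (m := 2 * k + 1) (n := j) (by omega) (by omega)
  have ha := P.a_nonneg
  have hb := P.b_nonneg
  rcases ha.eq_or_lt with h | h
  · rcases P.nondeg with h' | ⟨h', h''⟩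
    · linarith
    · rcases Nat.eq_zero_or_pos j with rfl | hj0
      · exact Or.inr ⟨by rw [minor_zero hk, ← h], h', h.symm, rfl, h'' rfl⟩
      · have h3 := cheb_pos (m := 2 * k + 1) (n := j) hj0 (by omega)
        left
        unfold minor
        positivity
  · left
    unfold minor
    positivity

theorem axial_of_major_eq_zero (P : Position hk l j p u d e a b) (hj : j + 1 < 2 * k + 1)
    (hu : u = p * endAlt _ l (j + 1)) (h0 : major k a b j = 0) :
    Axial k l u ∧ (l = true → ∃ n : ℕ, u = theta k ^ (n + 1)) := by
  have hj2 : j = 2 * k - 1 := by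
    by_contra hne
    exact (P.major_pos (by omega)).ne' h0
  subst hj2
  have e1 : 2 * k - 1 + 1 = 2 * k := by omega
  have e2 : 2 * k - 1 + 2 = 2 * k + 1 := by omega
  have hb : b = 0 := by
    have h2 := cheb_pos (m := 2 * k + 1) (n := 2 * k) (by omega) (by omega)
    rw [major, e1, e2, cheb_self (by omega)] at h0
    simpa [h2.ne'] using h0
  have hodd : (2 * k - 1).bodd = true := by
    have h := Nat.bodd_succ (2 * k - 1)
    rw [Nat.succ_eq_add_one, e1, Nat.bodd_mul] at h
    simpa using h.symm
  have hp := P.axial hb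
  rw [hodd, Bool.xor_true] at hp
  rw [e1] at hu
  cases l
  · obtain ⟨n, rfl⟩ := hp
    exact ⟨⟨n, hu⟩, by simp⟩
  · obtain ⟨n, rfl⟩ := hp
    rw [mul_assoc, theta_eq, ← pow_succ] at hu
    exact ⟨⟨n + 1, hu⟩, fun _ => ⟨n, hu⟩⟩

end Position

theorem sign_mul_self_mul {e x y : ℝ} (he : e * e = 1) :
    SignType.sign (e * x * (e * y)) = SignType.sign (x * y) := by
  rw [mul_mul_mul_comm, he, one_mul]

theorem Reduced.exists_position {k : ℕ} (hk : 1 ≤ k) {l j p u d} (h : Reduced k l j p u d) :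
    ∃ e a b, Position hk l j p u d e a b := by
  have hc : 0 < cheb (2 * k + 1) 2 := cheb_pos (by omega) (by omega)
  induction h with
  | single l =>
    cases l
    · refine ⟨-1, 0, 1, ?_⟩
      have hx := xc_mul_t hk 1
      have hy := yc_mul_t hk 1
      rw [one_mul, xc_one] at hx hy
      rw [yc_one] at hy
      constructor <;> simp [minor_zero hk, major_zero hk, hx, hy, height_t]
    · refine ⟨1, 1, 0, ?_⟩
      have hx := xc_mul_s hk 1
      have hy := yc_mul_s hk 1
      rw [one_mul, yc_one] at hx hy
      rw [xc_one] at hx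
      constructor <;> simp [minor_zero hk, major_zero hk, hx, hy, height_s, hc.ne']
      exact ⟨0, by simp⟩
  | @same l j p u d h ih =>
    obtain ⟨e, a, b, P⟩ := ih
    have hj := h.lt hk
    have hA := P.major_nonneg hj
    have hB := P.minor_nonneg hj
    have hAx := P.axial_of_major_eq_zero hj h.eq_mul_endAlt
    have hBor := P.minor_pos_or hj
    have hX := P.xc_eq
    have hY := P.yc_eq
    refine ⟨e, minor k a b j, major k a b j, P.sq_eq, hB, hA, ?_, ?_, ?_, ?_, ?_, ?_, ?_, ?_⟩
    · rcases hBor with h' | ⟨-, hb, ha, rfl, rfl, rfl⟩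
      · exact Or.inl h'
      · exact Or.inr ⟨by rw [major_zero hk, ha]; linarith, fun _ => ⟨rfl, rfl⟩⟩
    · rw [minor_zero hk, major_zero hk]
      cases l
      · simpa [xc_mul_t] using hX
      · simp only [if_true] at hX hY ⊢
        rw [xc_mul_s, hX, hY]
        ring
    · rw [minor_zero hk, major_zero hk]
      cases l
      · simp only [Bool.false_eq_true, if_false] at hX hY ⊢
        rw [yc_mul_t, hX, hY]
        ring
      · simpa [yc_mul_s] using hY
    · intro h0
      simpa using (hAx h0).1
    · rintro rfl -
      simp only [if_true] at hX hY
      have hB' : 0 < minor k a b j := by simpa using hBor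
      rw [height_mul_s, xc_mul_s, hX, hY,
        show e * major k a b j + cheb (2 * k + 1) 2 * (e * minor k a b j) =
          e * (major k a b j + cheb (2 * k + 1) 2 * minor k a b j) by ring,
        sign_mul_self_mul P.sq_eq]
      rcases hA.eq_or_lt with h0 | h0
      · rw [P.height_s_zero rfl h0.symm, ← h0]
        simp
        ring
      · rw [P.height_s rfl h0, sign_pos (by positivity)]
        simp
    · rintro rfl h0
      rw [major_zero hk] at h0
      have hB' : 0 < minor k a b j := by simpa using hBor
      have : 0 < minor k a b j * cheb (2 * k + 1) 2 := by positivity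
      linarith
    · rintro rfl h0
      rw [minor_zero hk] at h0
      rw [height_mul_t, P.height_t rfl h0]
    · rintro rfl h0
      rw [minor_zero hk] at h0
      rw [height_mul_t, P.height_t_zero rfl h0]
  | @switch l j p u d h hj2 ih =>
    obtain ⟨e, a, b, P⟩ := ih
    have hj := h.lt hk
    have hA := P.major_pos hj2
    have hB := P.minor_nonneg hj
    have hBor := P.minor_pos_or hj
    have hX := P.xc_eq
    have hY := P.yc_eq
    have hnd : 0 < a ∨ 0 < b := P.nondeg.imp id And.left
    have haxial : b = 0 → Axial k (!l ^^ (j + 1).bodd) p := by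
      intro hb
      simpa using P.axial hb
    cases l
    · simp only [Bool.false_eq_true, if_false] at hX hY
      have hXs : xc hk (u * gen _ true) = -e * major k a b (j + 1) := by
        rw [xc_mul_s, hX, hY, major_succ hk]
        ring
      have hs : height hk (u * gen _ true) = height hk u + 1 +
          (SignType.sign (minor k a b j * major k a b (j + 1)) : SignType) := by
        rw [height_mul_s, hXs, hX,
          show e * minor k a b j * (-e * major k a b (j + 1)) =
            -(e * minor k a b j * (e * major k a b (j + 1))) by ring, Left.sign_neg,
          sign_mul_self_mul P.sq_eq]
        simp
      refine ⟨-e, a, b, by linarith [P.sq_eq], P.a_nonneg, P.b_nonneg,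
        hnd.imp id fun h => ⟨h, by omega⟩, by simpa using hXs, ?_, haxial, ?_, ?_, by simp, by simp⟩
      · simp [yc_mul_s, hY, minor_succ]
      · rintro - h0
        simp only [Bool.not_false, Bool.false_eq_true, if_false]
        rw [hs]
        rcases hBor with h' | ⟨h', -, -, -, -, rfl⟩
        · rw [P.height_t rfl h', sign_pos (by positivity)]
          push_cast
          simp
          ring
        · rw [P.height_t_zero rfl h', h']
          simp
      · rintro - h0
        simp only [Bool.not_false, Bool.false_eq_true, if_false]
        rw [hs, h0]
        rcases hBor with h' | ⟨-, h', ha, rfl, -, rfl⟩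
        · rw [P.height_t rfl h']
          simp
          ring
        · have h3 := cheb_pos (m := 2 * k + 1) (n := 2) (by omega) (by omega)
          simp [major, ha, h'.ne', h3.ne'] at h0
    · simp only [if_true] at hX hY
      refine ⟨e, a, b, P.sq_eq, P.a_nonneg, P.b_nonneg, hnd.imp id fun h => ⟨h, by omega⟩,
        ?_, ?_, haxial, by simp, by simp, ?_, ?_⟩
      · simp [xc_mul_t, hX, minor_succ]
      · simp only [Bool.not_true, Bool.false_eq_true, if_false]
        rw [yc_mul_t, hX, hY, major_succ hk]
        ring
      · rintro - -
        simp only [Bool.not_true, if_true]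
        rw [height_mul_t, P.height_s rfl hA]
      · rintro - h0
        rw [minor_succ] at h0
        linarith

/-! ### Tails and stripping -/

/-- The length homomorphism. -/
def lengthHom (m : ℕ) : DG m →* Multiplicative ℤ :=
  PresentedGroup.toGroup (f := fun _ => Multiplicative.ofAdd 1) (by
    intro r hr
    rw [dihedralRel, Set.mem_singleton_iff] at hr
    rw [hr, map_mul, map_inv, map_alt, map_alt, FreeGroup.lift_apply_of, FreeGroup.lift_apply_of,
      mul_inv_cancel])

/-- The length of an element. -/
def len {m : ℕ} (u : DG m) : ℤ := (lengthHom m u).toAdd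

theorem len_mul {m : ℕ} (u v : DG m) : len (u * v) = len u + len v := by simp [len]

theorem len_inv {m : ℕ} (u : DG m) : len u⁻¹ = -len u := by simp [len]

theorem len_one {m : ℕ} : len (1 : DG m) = 0 := by simp [len]

theorem len_gen (m : ℕ) (l : Bool) : len (gen m l) = 1 := by
  rw [len, gen, lengthHom, PresentedGroup.toGroup.of]
  rfl

theorem len_gen_pow (m : ℕ) (l : Bool) (n : ℕ) : len (gen m l ^ n) = n := by
  induction n with
  | zero => simp [len_one]
  | succ n ih => rw [pow_succ, len_mul, ih, len_gen]; simp

theorem len_nonneg {m : ℕ} {u : DG m} (hu : u ∈ Md m) : 0 ≤ len u := by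
  induction hu using Submonoid.closure_induction with
  | mem x hx =>
    rcases hx with rfl | rfl
    · exact (len_gen m true).symm ▸ zero_le_one
    · exact (len_gen m false).symm ▸ zero_le_one
  | one => rw [len_one]
  | mul x y _ _ hx hy => rw [len_mul]; omega

theorem exists_eq_mul_gen {m : ℕ} {u : DG m} (hu : u ∈ Md m) (h1 : u ≠ 1) :
    ∃ l, u * (gen m l)⁻¹ ∈ Md m := by
  induction hu using Submonoid.closure_induction_right with
  | one => exact absurd rfl h1
  | mul_right x hx y hy _ =>
    rcases hy with rfl | rfl
    · exact ⟨true, by rwa [mul_assoc, show sA m = gen m true from rfl, mul_inv_cancel, mul_one]⟩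
    · exact ⟨false, by rwa [mul_assoc, show tA m = gen m false from rfl, mul_inv_cancel, mul_one]⟩

/-- The submonoid generated by a letter. -/
abbrev letterMonoid (m : ℕ) (l : Bool) : Submonoid (DG m) := Submonoid.closure {gen m l}

theorem gen_pow_mem_letterMonoid (m : ℕ) (l : Bool) (n : ℕ) : gen m l ^ n ∈ letterMonoid m l :=
  Submonoid.mem_closure_singleton.2 ⟨n, rfl⟩

theorem tail_letterMonoid {m : ℕ} {u : DG m} (hu : u ∈ Md m) (l : Bool) :
    ∃ n : ℕ, tail (Md m) (letterMonoid m l) u = gen m l ^ n ∧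
      u * (gen m l ^ n)⁻¹ ∈ Md m ∧ u * (gen m l ^ n)⁻¹ * (gen m l)⁻¹ ∉ Md m := by
  classical
  set g := gen m l
  have hle : ∀ i n : ℕ, leR (Md m) (g ^ i) (g ^ n) ↔ i ≤ n := by
    intro i n
    constructor
    · intro h
      have := len_nonneg h
      rw [len_mul, len_inv, len_gen_pow, len_gen_pow] at this
      omega
    · intro h
      rw [leR, ← pow_sub g h]
      exact pow_mem (gen_mem m l) _
  have hbound : ∀ n : ℕ, u * (g ^ n)⁻¹ ∈ Md m → n ≤ (len u).toNat := by
    intro n h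
    have := len_nonneg h
    rw [len_mul, len_inv, len_gen_pow] at this
    omega
  set N := Nat.findGreatest (fun n => u * (g ^ n)⁻¹ ∈ Md m) (len u).toNat
  have hN : u * (g ^ N)⁻¹ ∈ Md m :=
    Nat.findGreatest_spec (P := fun n => u * (g ^ n)⁻¹ ∈ Md m) (Nat.zero_le _) (by simpa using hu)
  have hex : ∃ b : DG m, b ∈ letterMonoid m l ∧
      {c | c ∈ letterMonoid m l ∧ leR (Md m) c u} =
        {c | c ∈ letterMonoid m l ∧ leR (Md m) c b} := by
    refine ⟨g ^ N, gen_pow_mem_letterMonoid m l N, ?_⟩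
    ext c
    refine and_congr_right fun hc => ?_
    obtain ⟨i, rfl⟩ := Submonoid.mem_closure_singleton.1 hc
    rw [hle]
    constructor
    · intro h
      exact Nat.le_findGreatest (hbound i h) h
    · intro h
      have e : u * (g ^ i)⁻¹ = u * (g ^ N)⁻¹ * g ^ (N - i) := by
        rw [pow_sub g h]
        group
      rw [leR, e]
      exact mul_mem hN (pow_mem (gen_mem m l) _)
  have htail : tail (Md m) (letterMonoid m l) u = hex.choose := by
    rw [tail, dif_pos hex]
  obtain ⟨hb, heq⟩ := hex.choose_spec
  obtain ⟨n, hn⟩ := Submonoid.mem_closure_singleton.1 hb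
  rw [← hn] at heq htail
  have hmem : ∀ i, u * (g ^ i)⁻¹ ∈ Md m ↔ i ≤ n := by
    intro i
    have := Set.ext_iff.1 heq (g ^ i)
    have hi : g ^ i ∈ letterMonoid m l := gen_pow_mem_letterMonoid m l i
    simp only [Set.mem_ofPred_eq, hi, true_and] at this
    exact this.trans (hle i n)
  refine ⟨n, htail, (hmem n).2 le_rfl, ?_⟩
  rw [mul_assoc, ← _root_.mul_inv_rev, ← pow_succ', hmem]
  omega

theorem strip_succ_left {G : Type*} [Group G] (M X Y : Submonoid G) (i : ℕ) (a : G) :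
    strip M X Y (i + 1) a = strip M Y X i (a * (tail M X a)⁻¹) := by
  induction i with
  | zero => simp [strip]
  | succ i ih =>
    rw [strip, ih, strip]
    rcases Nat.mod_two_eq_zero_or_one i with h | h
    · rw [if_neg (by omega), if_pos h]
    · rw [if_pos (by omega), if_neg (by omega)]

theorem Reduced.mul_gen_pow {k : ℕ} {l j p u d} (h : Reduced k l j p u d) (n : ℕ) :
    ∃ j' p', Reduced k l j' p' (u * gen _ l ^ n) d := by
  induction n with
  | zero => exact ⟨j, p, by simpa using h⟩
  | succ n ih =>
    obtain ⟨j', p', h'⟩ := ih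
    exact ⟨_, _, by simpa only [pow_succ, mul_assoc] using h'.same⟩

theorem omega_mul_inv_gen_mem (k : ℕ) (l : Bool) :
    Ωd (2 * k + 1) * (gen _ l)⁻¹ ∈ Md (2 * k + 1) := by
  rw [← endAlt_mul_gen k l, mul_inv_cancel_right, endAlt_two_mul]
  exact pow_mem (mul_mem (gen_mem _ _) (gen_mem _ _)) _

theorem exists_reduced {k : ℕ} (hk : 1 ≤ k) (n : ℕ) : ∀ u ∈ Md (2 * k + 1), len u ≤ n →
    ∀ l, u ≠ 1 → u * (gen _ (!l))⁻¹ ∉ Md (2 * k + 1) →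
    ∃ r j p d, Reduced k l j p u d ∧
      strip (Md _) (letterMonoid _ l) (letterMonoid _ (!l)) (r + 1) u = 1 ∧
      (∀ q ≤ r, strip (Md _) (letterMonoid _ l) (letterMonoid _ (!l)) q u ≠ 1) ∧
      d = if l then (r + 2) / 2 else (r + 1) / 2 := by
  induction n with
  | zero =>
    intro u hu hlen l h1
    obtain ⟨l', hl'⟩ := exists_eq_mul_gen hu h1
    have := len_nonneg hl'
    rw [len_mul, len_inv, len_gen] at this
    push_cast at hlen
    omega
  | succ n ih =>
    intro u hu hlen l h1 hndvd
    obtain ⟨i, htail, hmem, hmax⟩ := tail_letterMonoid hu l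
    have hl : u * (gen _ l)⁻¹ ∈ Md (2 * k + 1) := by
      obtain ⟨l', hl'⟩ := exists_eq_mul_gen hu h1
      rcases Bool.eq_or_eq_not l' l with rfl | rfl
      · exact hl'
      · exact absurd hl' hndvd
    obtain ⟨i, rfl⟩ : ∃ i', i = i' + 1 := by
      refine ⟨i - 1, ?_⟩
      rcases Nat.eq_zero_or_pos i with rfl | h
      · exact absurd hl (by simpa using hmax)
      · omega
    set v := u * (gen _ l ^ (i + 1))⁻¹ with hv
    have huv : u = v * gen _ l ^ (i + 1) := by rw [hv, inv_mul_cancel_right]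
    by_cases hv1 : v = 1
    · obtain ⟨j, p, hred⟩ := (Reduced.single (k := k) l).mul_gen_pow i
      rw [← pow_succ', ← one_mul (gen _ l ^ (i + 1)), ← hv1, ← huv] at hred
      refine ⟨0, j, p, _, hred, ?_, ?_, by cases l <;> rfl⟩
      · rw [strip_succ_left, htail]
        exact hv1
      · intro q hq
        obtain rfl : q = 0 := by omega
        exact h1
    · have hlv : len v ≤ n := by
        rw [hv, len_mul, len_inv, len_gen_pow]
        push_cast at hlen ⊢
        omega
      obtain ⟨r, j, p, d, hred, hs, hs', hd⟩ := ih v hmem hlv (!l) hv1 (by simpa using hmax)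
      rw [Bool.not_not] at hs hs'
      have hj : j + 2 < 2 * k + 1 := by
        by_contra hj
        have hj1 := hred.lt hk
        obtain rfl : j = 2 * k - 1 := by omega
        apply hndvd
        have hv' := hred.eq_mul_endAlt
        rw [show 2 * k - 1 + 1 = 2 * k by omega] at hv'
        have hpow := gen_pow_mul_omega k (!l) i
        rw [Bool.not_not] at hpow
        rw [huv, hv', pow_succ', mul_assoc p, ← mul_assoc (endAlt _ _ _), endAlt_mul_gen, ← hpow,
          mul_assoc, mul_assoc]
        exact mul_mem hred.mem.1
          (mul_mem (pow_mem (gen_mem _ _) _) (omega_mul_inv_gen_mem k _))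
      have hsw := hred.switch hj
      rw [Bool.not_not] at hsw
      obtain ⟨j', p', hred'⟩ := hsw.mul_gen_pow i
      rw [mul_assoc, ← pow_succ', ← huv] at hred'
      refine ⟨r + 1, j', p', _, hred', ?_, ?_, ?_⟩
      · rw [strip_succ_left, htail]
        exact hs
      · intro q hq
        cases q with
        | zero => exact h1
        | succ q =>
          rw [strip_succ_left, htail]
          exact hs' q (by omega)
      · rw [hd]
        cases l
        · simp
          omega
        · simp

/-! ### Depth and height -/

theorem height_mul_t_pow {k : ℕ} (hk : 1 ≤ k) (u : DG (2 * k + 1)) (n : ℕ) :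
    height hk (u * gen _ false ^ n) = height hk u ∧ xc hk (u * gen _ false ^ n) = xc hk u := by
  induction n with
  | zero => simp
  | succ n ih => rw [pow_succ, ← mul_assoc, height_mul_t, xc_mul_t]; exact ih

theorem dpt_spec {k : ℕ} (hk : 1 ≤ k) {a : DG (2 * k + 1)} (ha : a ∈ Md (2 * k + 1)) :
    (a ∈ M₁d (2 * k + 1) ∧ dpt (Md _) (M₁d _) (Nd _) a = 0) ∨
    (xc hk a ≠ 0 ∧ height hk a = 2 * (dpt (Md _) (M₁d _) (Nd _) a : ℤ) - 1) ∨
    (a ∈ thetaSet (M₁d (2 * k + 1)) (theta k) ∧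
      height hk a = 2 * (dpt (Md _) (M₁d _) (Nd _) a : ℤ) - 2) := by
  obtain ⟨i, htail, hmem, hmax⟩ := tail_letterMonoid ha false
  set u := a * (gen _ false ^ i)⁻¹ with hu
  have hau : a = u * gen _ false ^ i := by rw [hu, inv_mul_cancel_right]
  have hti : gen (2 * k + 1) false ^ i ∈ M₁d (2 * k + 1) :=
    gen_pow_mem_letterMonoid _ false i
  have hstrip : ∀ q, strip (Md _) (M₁d _) (Nd _) (q + 1) a =
      strip (Md _) (letterMonoid _ true) (letterMonoid _ (!true)) q u := by
    intro q
    rw [hu, ← htail]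
    exact strip_succ_left _ _ _ _ _
  by_cases hu1 : u = 1
  · left
    refine ⟨by rw [hau, hu1, one_mul]; exact hti, ?_⟩
    have : bh (Md _) (M₁d _) (Nd _) a ≤ 1 := Nat.sInf_le ⟨le_rfl, by rw [hstrip]; exact hu1⟩
    rw [dpt]
    omega
  · right
    obtain ⟨r, j, p, d, hred, hs, hs', hd⟩ :=
      exists_reduced hk (len u).toNat u hmem (by omega) true hu1 hmax
    have hbh : bh (Md _) (M₁d _) (Nd _) a = r + 2 := by
      apply le_antisymm
      · exact Nat.sInf_le ⟨by omega, by rw [hstrip]; exact hs⟩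
      · refine le_csInf ⟨r + 2, by omega, by rw [hstrip]; exact hs⟩ ?_
        rintro q ⟨hq1, hq⟩
        obtain ⟨q, rfl⟩ : ∃ q', q = q' + 1 := ⟨q - 1, by omega⟩
        rw [hstrip] at hq
        by_contra hlt
        exact hs' q (by omega) hq
    have hdpt : dpt (Md _) (M₁d _) (Nd _) a = d := by
      rw [dpt, hbh, hd]
      rfl
    obtain ⟨e, x, y, P⟩ := hred.exists_position hk
    have hj := hred.lt hk
    obtain ⟨hh, hx⟩ := height_mul_t_pow hk u i
    rw [← hau] at hh hx
    rw [hdpt, hh, hx]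
    rcases (P.major_nonneg hj).eq_or_lt with h0 | h0
    · right
      refine ⟨?_, P.height_s_zero rfl h0.symm⟩
      obtain ⟨n, hn⟩ := (P.axial_of_major_eq_zero hj hred.eq_mul_endAlt h0.symm).2 rfl
      exact ⟨n + 1, by omega, _, hti, by rw [hau, hn]⟩
    · left
      refine ⟨?_, P.height_s rfl h0⟩
      have he : e ≠ 0 := by
        rintro rfl
        simpa using P.sq_eq
      rw [P.xc_eq, if_pos rfl]
      exact mul_ne_zero he h0.ne'

section Stabilizer

variable {k : ℕ} (hk : 1 ≤ k)

theorem xc_zero_transitive (u v : DG (2 * k + 1)) :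
    (xc hk u = 0 → xc hk v = 0 → xc hk (u * v) = 0) ∧
    (xc hk u = 0 → xc hk (u * v) = 0 → xc hk v = 0) ∧
    (xc hk v = 0 → xc hk (u * v) = 0 → xc hk u = 0) := by
  simpa [xc] using low_zero_transitive (lift hk u).mat (lift hk v).mat

theorem height_mul_of_right {v : DG (2 * k + 1)} (hv : xc hk v = 0) (u : DG (2 * k + 1)) :
    height hk (u * v) = height hk u + height hk v := by
  simp [height_mul, hv]

theorem xc_eq_zero_of_commute {u : DG (2 * k + 1)} (h : Commute (tA _) u) : xc hk u = 0 := by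
  have hc : 0 < cheb (2 * k + 1) 2 := cheb_pos (by omega) (by omega)
  have h' : gen _ false * u = u * gen _ false := h
  have h1 := congrArg (fun w => yc hk w) h'
  simp only [yc_mul_t] at h1
  have h2 : yc hk (gen _ false * u) = yc hk u := by
    rw [yc, map_mul, lift_gen, Ext.mat_mul, mul_apply_one_one]
    simp [extGen, matT, yc]
  rw [h2] at h1
  have h3 : cheb (2 * k + 1) 2 * xc hk u = 0 := by linarith
  simpa [hc.ne'] using h3

theorem commute_omega_sq (l : Bool) : Commute (gen _ l) (Ωd (2 * k + 1) ^ 2) := by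
  have h1 := gen_mul_omega k l
  have h2 := gen_mul_omega k (!l)
  rw [Bool.not_not] at h2
  rw [Commute, SemiconjBy, pow_two, ← mul_assoc, h1, mul_assoc, h2, mul_assoc]

theorem commute_theta : Commute (tA _) (theta k) :=
  (commute_omega_sq false).mul_right ((Commute.refl _).pow_right 2).inv_right

theorem height_omega : height hk (Ωd (2 * k + 1)) = 2 * k - 1 := by
  have h := endAlt_mul_gen k false
  rw [Bool.not_false, endAlt_two_mul] at h
  rw [← h, height_mul_t, height, map_pow, map_mul, lift_gen, lift_gen]
  obtain ⟨n, rfl⟩ : ∃ n, k = n + 1 := ⟨k - 1, by omega⟩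
  rw [Bool.not_true, (extGen_ts_pow n (by omega)).1]
  push_cast
  ring

theorem xc_omega_sq_zpow (n : ℤ) : xc hk ((Ωd (2 * k + 1) ^ 2) ^ n) = 0 :=
  xc_eq_zero_of_commute hk ((commute_omega_sq false).zpow_right n)

theorem height_omega_sq : height hk (Ωd (2 * k + 1) ^ 2) = 2 * (2 * k - 1) := by
  have hx : xc hk (Ωd (2 * k + 1) ^ 2) = 0 := by simpa using xc_omega_sq_zpow hk 1
  have h : height hk (Ωd (2 * k + 1) * Ωd (2 * k + 1)) = _ := height_mul hk _ _
  rw [← pow_two, hx, height_omega] at h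
  rw [h]
  simp
  ring

theorem height_omega_sq_zpow (n : ℤ) :
    height hk ((Ωd (2 * k + 1) ^ 2) ^ n) = 2 * (2 * k - 1) * n := by
  have hx : xc hk (Ωd (2 * k + 1) ^ 2) = 0 := by simpa using xc_omega_sq_zpow hk 1
  induction n with
  | zero => simp [height_one]
  | succ n ih => rw [_root_.zpow_add_one, height_mul_of_right hk hx, ih, height_omega_sq]; ring
  | pred n ih =>
    have h := height_mul_of_right hk hx ((Ωd (2 * k + 1) ^ 2) ^ (-(n : ℤ) - 1))
    rw [← _root_.zpow_add_one, sub_add_cancel, ih, height_omega_sq] at h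
    linarith

theorem xc_of_mem_M₁ {a : DG (2 * k + 1)} (ha : a ∈ M₁d (2 * k + 1)) :
    xc hk a = 0 ∧ height hk a = 0 := by
  obtain ⟨n, rfl⟩ := Submonoid.mem_closure_singleton.1 ha
  have h := height_mul_t_pow hk 1 n
  rw [one_mul, height_one, xc_one] at h
  exact ⟨h.2, h.1⟩

theorem height_theta_pow (n : ℕ) : height hk (theta k ^ n) = 2 * (2 * k - 1) * n := by
  have hx := xc_eq_zero_of_commute hk commute_theta
  have hθ : height hk (theta k) = 2 * (2 * k - 1) := by
    have h := (height_mul_t_pow hk (theta k) 2).1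
    rw [← h, ← height_omega_sq hk]
    exact congrArg _ (inv_mul_cancel_right _ _)
  induction n with
  | zero => simp [height_one]
  | succ n ih =>
    rw [pow_succ, height_mul_of_right hk hx, ih, hθ]
    push_cast
    ring

theorem xc_of_mem_thetaSet {a : DG (2 * k + 1)}
    (ha : a ∈ thetaSet (M₁d (2 * k + 1)) (theta k)) : xc hk a = 0 ∧ 0 < height hk a := by
  obtain ⟨n, hn, b, hb, rfl⟩ := ha
  obtain ⟨hb1, hb2⟩ := xc_of_mem_M₁ hk hb
  refine ⟨(xc_zero_transitive hk _ _).1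
    (xc_eq_zero_of_commute hk (commute_theta.pow_right n)) hb1, ?_⟩
  rw [height_mul_of_right hk hb1, hb2, height_theta_pow, add_zero]
  have : (0 : ℤ) < 2 * k - 1 := by omega
  positivity

/-- The three possible positions of an element of the monoid, with all the data they determine. -/
theorem depth_trichotomy {a : DG (2 * k + 1)} (ha : a ∈ Md (2 * k + 1)) :
    (a ∈ M₁d (2 * k + 1) ∧ a ∉ thetaSet (M₁d (2 * k + 1)) (theta k) ∧ xc hk a = 0 ∧
      height hk a = 2 * (dpt (Md _) (M₁d _) (Nd _) a : ℤ)) ∨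
    (a ∉ M₁d (2 * k + 1) ∧ a ∉ thetaSet (M₁d (2 * k + 1)) (theta k) ∧ xc hk a ≠ 0 ∧
      height hk a = 2 * (dpt (Md _) (M₁d _) (Nd _) a : ℤ) - 1) ∨
    (a ∉ M₁d (2 * k + 1) ∧ a ∈ thetaSet (M₁d (2 * k + 1)) (theta k) ∧ xc hk a = 0 ∧
      height hk a = 2 * (dpt (Md _) (M₁d _) (Nd _) a : ℤ) - 2) := by
  have h1 := fun h => xc_of_mem_M₁ hk (a := a) h
  have h2 := fun h => xc_of_mem_thetaSet hk (a := a) h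
  rcases dpt_spec hk ha with ⟨hm, hd⟩ | ⟨hx, hd⟩ | ⟨hm, hd⟩
  · refine Or.inl ⟨hm, fun h => ?_, (h1 hm).1, by rw [hd, (h1 hm).2]; rfl⟩
    have := (h1 hm).2
    have := (h2 h).2
    omega
  · exact Or.inr (Or.inl ⟨fun h => hx (h1 h).1, fun h => hx (h2 h).1, hx, hd⟩)
  · refine Or.inr (Or.inr ⟨fun h => ?_, hm, (h2 hm).1, hd⟩)
    have := (h1 h).2
    have := (h2 hm).2
    omega

theorem omega_sq_mem : Ωd (2 * k + 1) ^ 2 ∈ Md (2 * k + 1) := by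
  have h := mul_mem (omega_mul_inv_gen_mem k true) (gen_mem (2 * k + 1) true)
  rw [inv_mul_cancel_right] at h
  exact pow_mem h 2

end Stabilizer

theorem condA_dihedral {k : ℕ} (hk : 1 ≤ k) :
    CondA (Md (2 * k + 1)) (M₁d (2 * k + 1)) (Nd (2 * k + 1)) (Ωd (2 * k + 1) ^ 2)
      (2 * k - 1) := by
  intro n hn
  have hx := xc_omega_sq_zpow hk n
  have hh := height_omega_sq_zpow hk n
  rw [zpow_natCast] at hx hh
  have hpos : (0 : ℤ) < 2 * (2 * k - 1) * n := by
    have : (0 : ℤ) < 2 * k - 1 := by omega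
    positivity
  zify [show 1 ≤ 2 * k by omega]
  rcases depth_trichotomy hk (pow_mem omega_sq_mem n) with ⟨hm, -⟩ | ⟨-, -, h, -⟩ | ⟨-, -, -, h⟩
  · have := (xc_of_mem_M₁ hk hm).2
    omega
  · exact absurd hx h
  · linarith

/-- The arithmetic of Condition B: `a`, `b`, `c` have depths `da`, `db`, `dc` and heights
`ha`, `hb`, `hc`; `A`, `B`, `C` stand for membership in `M₁`, `A'`, `B'`, `C'` for membership
in `Θ`, and `X`, `Y`, `Z` for the vanishing of `xc`. -/
theorem exists_defect {A A' B B' C C' X Y Z : Prop} {ha hb hc da db dc σ z : ℤ}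
    (hab : ¬((A' ∨ A) ∧ (B' ∨ B))) (hh : ha + hb - σ = hc + 2 * z)
    (hA : A ∧ ¬A' ∧ X ∧ ha = 2 * da ∨ ¬A ∧ ¬A' ∧ ¬X ∧ ha = 2 * da - 1 ∨
      ¬A ∧ A' ∧ X ∧ ha = 2 * da - 2)
    (hB : B ∧ ¬B' ∧ Y ∧ hb = 2 * db ∨ ¬B ∧ ¬B' ∧ ¬Y ∧ hb = 2 * db - 1 ∨
      ¬B ∧ B' ∧ Y ∧ hb = 2 * db - 2)
    (hC : C ∧ ¬C' ∧ Z ∧ hc = 2 * dc ∨ ¬C ∧ ¬C' ∧ ¬Z ∧ hc = 2 * dc - 1 ∨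
      ¬C ∧ C' ∧ Z ∧ hc = 2 * dc - 2)
    (htr : (X → Y → Z) ∧ (X → Z → Y) ∧ (Y → Z → X))
    (hσ : σ = 0 ∨ σ = 1 ∨ σ = -1) (hσ0 : σ = 0 ↔ X ∨ Y ∨ Z) :
    ∃ ε : ℕ, ε ≤ 1 ∧ dc = da + db - z - (ε : ℤ) ∧ (A' ∨ B' ∨ C → ε = 1) := by
  have key : (dc = da + db - z ∧ ¬(A' ∨ B' ∨ C)) ∨ dc = da + db - z - 1 := by grind
  rcases key with ⟨h, hn⟩ | h
  · exact ⟨0, zero_le_one, by simpa using h, fun h' => absurd h' hn⟩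
  · exact ⟨1, le_rfl, by simpa using h, fun _ => rfl⟩

theorem condB_dihedral {k : ℕ} (hk : 1 ≤ k) :
    CondB (Md (2 * k + 1)) (M₁d (2 * k + 1)) (Nd (2 * k + 1)) (Ωd (2 * k + 1) ^ 2)
      (theta k) (2 * k - 1) := by
  rintro a b c n ⟨ha, -⟩ ⟨hb, -⟩ hab ⟨hc, -⟩ heq
  have hΔ := xc_omega_sq_zpow hk n
  have hhc := height_mul_of_right hk hΔ c
  rw [← heq, height_omega_sq_zpow, height_mul] at hhc
  have hxc : xc hk (a * b) = 0 ↔ xc hk c = 0 := by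
    have h := xc_zero_transitive hk c ((Ωd (2 * k + 1) ^ 2) ^ n)
    rw [← heq] at h
    exact ⟨h.2.2 hΔ, fun h' => h.1 h' hΔ⟩
  have htr := xc_zero_transitive hk a b
  have hζ : ((2 * k - 1 : ℕ) : ℤ) = 2 * k - 1 := by omega
  rw [hζ]
  have hassoc : 2 * (2 * (k : ℤ) - 1) * n = 2 * ((2 * k - 1) * n) := by ring
  rw [hassoc] at hhc
  generalize (2 * (k : ℤ) - 1) * n = z at *
  have hbar : ∀ x : DG (2 * k + 1), x ∈ thetaBar (M₁d (2 * k + 1)) (theta k) ↔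
      x ∈ thetaSet (M₁d (2 * k + 1)) (theta k) ∨ x ∈ M₁d (2 * k + 1) := fun x => Iff.rfl
  rw [hbar, hbar] at hab
  generalize hσ : ((SignType.sign (xc hk a * xc hk b * xc hk (a * b)) : SignType) : ℤ) = σ at hhc
  have hσ0 : xc hk a = 0 ∨ xc hk b = 0 ∨ xc hk (a * b) = 0 → σ = 0 := by
    rintro (h | h | h) <;> simp [← hσ, h]
  have hσ1 : σ = 0 ∨ σ = 1 ∨ σ = -1 := by
    rw [← hσ]
    cases SignType.sign (xc hk a * xc hk b * xc hk (a * b)) <;> simp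
  have hσ2 : σ = 0 → xc hk a = 0 ∨ xc hk b = 0 ∨ xc hk (a * b) = 0 := by
    intro h
    rw [← hσ] at h
    have h' : SignType.sign (xc hk a * xc hk b * xc hk (a * b)) = 0 := by
      revert h
      cases SignType.sign (xc hk a * xc hk b * xc hk (a * b)) <;> simp
    simpa [sign_eq_zero_iff, or_assoc] using h'
  rw [hxc] at htr hσ0 hσ2
  exact exists_defect hab hhc (depth_trichotomy hk ha) (depth_trichotomy hk hb)
    (depth_trichotomy hk hc) htr hσ1 ⟨hσ2, hσ0⟩

end DihedralArtin
open GarsideOrder DihedralArtin in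
/-- In the Artin group of type `I₂(m)` with `m = 2k + 1` odd (`m ≥ 5`), with `Ω = Π(s,t,m)`,
`Δ = Ω²`, `M₁ = ⟨t⟩⁺`, `N = ⟨s⟩⁺`, `Δ₁ = t²` and `θ = Δ Δ₁⁻¹`, the pair `(H, G₁)` satisfies
Condition A with constant `ζ = 2k - 1` and Condition B with constant `ζ = 2k - 1`. -/
theorem statement19 (k : ℕ) (hk : 2 ≤ k) :
    CondA (Md (2 * k + 1)) (M₁d (2 * k + 1)) (Nd (2 * k + 1)) (Ωd (2 * k + 1) ^ 2)
      (2 * k - 1) ∧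
    CondB (Md (2 * k + 1)) (M₁d (2 * k + 1)) (Nd (2 * k + 1)) (Ωd (2 * k + 1) ^ 2)
      (Ωd (2 * k + 1) ^ 2 * ((tA (2 * k + 1)) ^ 2)⁻¹) (2 * k - 1) := by
  have h : 1 ≤ k := by omega
  exact ⟨condA_dihedral h, condB_dihedral h⟩
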